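/- arXiv:math/0512164 — 3 statements merged into one kernel-verified Lean document; each statement's English description precedes it below -/
import Mathlib

section
/- Let G be a finite simple graph on n vertices with edge weights w_{ij} in a commutative ring, and let L_G be its weighted Laplacian matrix. Then any principal minor of L_G (deleting row i and column i) equals the sum over all spanning trees T of G of the product of the weights of the edges of T. -/
open Finset
open scoped Classical

namespace MatrixTree

variable {V : Type*}

/-- A map `p` sending each vertex other than `r` to a parent is a parent map if some rank
function strictly decreases along it; equivalently, iterating `p` always ends in `r`. -/
def IsParentMap {r : V} (p : {v // v ≠ r} → V) : Prop :=
  ∃ d : V → ℕ, ∀ v, d (p v) < d v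

/-- The graph joining each vertex other than `r` to its image under `p`. -/
def parentGraph {r : V} (p : {v // v ≠ r} → V) : SimpleGraph V :=
  SimpleGraph.fromEdgeSet (Set.range fun v : {v // v ≠ r} => s((v : V), p v))

/-- The matrix whose row `v` is the difference of the basis vectors at `v` and `p v`,
the basis vector at `r` being omitted. -/
noncomputable def parentMatrix (R : Type*) [CommRing R] {r : V} (p : {v // v ≠ r} → V) :
    Matrix {v // v ≠ r} {v // v ≠ r} R :=
  fun v u => (if (v : V) = u then 1 else 0) - (if p v = u then 1 else 0)

variable {r : V} {p : {v // v ≠ r} → V}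

theorem exists_mem_iff_of_not_isParentMap (hp : ¬ IsParentMap p) :
    ∃ C : Set V, r ∉ C ∧ C.Nonempty ∧ ∀ v : {v // v ≠ r}, (v : V) ∈ C ↔ p v ∈ C := by
  let g : V → V := fun v => if h : v = r then r else p ⟨v, h⟩
  have hg (v : {v // v ≠ r}) : g v = p v := by simp [g, v.2]
  have hgr : g r = r := by simp [g]
  refine ⟨{v | ∀ k, g^[k] v ≠ r}, fun h => h 0 rfl, ?_, fun v => ⟨fun h k => ?_, fun h k => ?_⟩⟩
  · by_contra hC
    have hreach (v : V) : ∃ k, g^[k] v = r := by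
      by_contra! hv
      exact hC ⟨v, hv⟩
    refine hp ⟨fun v => Nat.find (hreach v), fun v => ?_⟩
    have hs := Nat.find_spec (hreach v)
    obtain ⟨m, hm⟩ : ∃ m, Nat.find (hreach v) = m + 1 := by
      refine Nat.exists_eq_succ_of_ne_zero fun h0 => v.2 ?_
      simpa [h0] using hs
    rw [hm, Function.iterate_succ_apply, hg] at hs
    have := Nat.find_min' (hreach (p v)) hs
    show Nat.find (hreach (p v)) < Nat.find (hreach v)
    omega
  · have := h (k + 1)
    rwa [Function.iterate_succ_apply, hg] at this
  · cases k with
    | zero => exact v.2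
    | succ k => rw [Function.iterate_succ_apply, hg]; exact h k

theorem IsParentMap.ne (hp : IsParentMap p) (v : {v // v ≠ r}) : (v : V) ≠ p v := by
  obtain ⟨d, hd⟩ := hp
  intro h
  have := hd v
  rw [← h] at this
  exact lt_irrefl _ this

theorem IsParentMap.injective_edge (hp : IsParentMap p) :
    Function.Injective fun v : {v // v ≠ r} => s((v : V), p v) := by
  obtain ⟨d, hd⟩ := hp
  intro v u h
  rcases Sym2.eq_iff.1 h with ⟨h, -⟩ | ⟨h₁, h₂⟩
  · exact Subtype.ext h
  · have hv := hd v
    have hu := hd u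
    rw [h₂] at hv
    rw [← h₁] at hu
    omega

theorem IsParentMap.edgeSet_parentGraph (hp : IsParentMap p) :
    (parentGraph p).edgeSet = Set.range fun v : {v // v ≠ r} => s((v : V), p v) := by
  rw [parentGraph, SimpleGraph.edgeSet_fromEdgeSet, sdiff_eq_left]
  rw [Set.disjoint_left]
  rintro _ ⟨v, rfl⟩ h
  exact hp.ne v (by simpa using h)

theorem IsParentMap.adj (hp : IsParentMap p) (v : {v // v ≠ r}) :
    (parentGraph p).Adj v (p v) := by
  rw [← SimpleGraph.mem_edgeSet, hp.edgeSet_parentGraph]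
  exact ⟨v, rfl⟩

theorem IsParentMap.connected (hp : IsParentMap p) : (parentGraph p).Connected := by
  obtain ⟨d, hd⟩ := id hp
  have key (v : V) : (parentGraph p).Reachable v r := by
    induction h : d v using Nat.strong_induction_on generalizing v with
    | _ m ih =>
      by_cases hv : v = r
      · rw [hv]
      · exact (hp.adj ⟨v, hv⟩).reachable.trans (ih _ (h ▸ hd ⟨v, hv⟩) _ rfl)
  have : Nonempty V := ⟨r⟩
  exact ⟨fun u v => (key u).trans (key v).symm⟩

theorem IsParentMap.isTree [Fintype V] (hp : IsParentMap p) : (parentGraph p).IsTree := by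
  rw [SimpleGraph.isTree_iff_connected_and_card]
  refine ⟨hp.connected, ?_⟩
  rw [hp.edgeSet_parentGraph, Nat.card_range_of_injective hp.injective_edge]
  have := Fintype.card_pos_iff.2 ⟨r⟩
  rw [Nat.card_eq_fintype_card, Nat.card_eq_fintype_card, Fintype.card_subtype_compl,
    Fintype.card_subtype_eq]
  omega

theorem IsParentMap.eq_of_parentGraph_eq {q : {v // v ≠ r} → V} (hp : IsParentMap p)
    (hq : IsParentMap q) (h : parentGraph p = parentGraph q) : p = q := by
  obtain ⟨d, hd⟩ := id hp
  have key (m : ℕ) : ∀ v : {v // v ≠ r}, d v = m → p v = q v := by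
    induction m using Nat.strong_induction_on with
    | _ m ih =>
      intro v hv
      have hadj := hp.adj v
      rw [h, ← SimpleGraph.mem_edgeSet, hq.edgeSet_parentGraph] at hadj
      obtain ⟨u, hu⟩ := hadj
      rcases Sym2.eq_iff.1 hu with ⟨h₁, h₂⟩ | ⟨h₁, h₂⟩
      · obtain rfl : u = v := Subtype.ext h₁
        exact h₂.symm
      · have hlt := hd v
        have hpu := ih (d u) (by rw [h₁]; omega) u rfl
        have := hd u
        rw [hpu, h₂, h₁] at this
        omega
  exact funext fun v => key _ v rfl

theorem exists_parentGraph_eq [Fintype V] (r : V) {T : SimpleGraph V} (hT : T.IsTree) :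
    ∃ p : {v // v ≠ r} → V, IsParentMap p ∧ parentGraph p = T := by
  have hstep (v : {v // v ≠ r}) : ∃ u, T.Adj v u ∧ T.dist u r < T.dist v r := by
    obtain ⟨v, hv⟩ := v
    obtain ⟨W, hW⟩ := hT.connected.exists_walk_length_eq_dist v r
    cases W with
    | nil => exact absurd rfl hv
    | cons h W' =>
      refine ⟨_, h, ?_⟩
      rw [SimpleGraph.Walk.length_cons] at hW
      have := SimpleGraph.dist_le W'
      show _ < T.dist v r
      omega
  choose p hadj hdist using hstep
  have hp : IsParentMap p := ⟨fun v => T.dist v r, hdist⟩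
  refine ⟨p, hp, ?_⟩
  have hle : parentGraph p ≤ T := by
    rw [← SimpleGraph.edgeSet_subset_edgeSet, hp.edgeSet_parentGraph]
    rintro _ ⟨v, rfl⟩
    exact hadj v
  exact le_antisymm hle ((SimpleGraph.isTree_iff_minimal_connected.1 hT).2 hp.connected hle)

variable [Fintype V] {R : Type*} [CommRing R]

theorem IsParentMap.prod_edgeFinset (hp : IsParentMap p) (f : Sym2 V → R) :
    ∏ e ∈ (parentGraph p).edgeFinset, f e = ∏ v : {v // v ≠ r}, f s((v : V), p v) := by
  have : (parentGraph p).edgeFinset = univ.image fun v : {v // v ≠ r} => s((v : V), p v) := by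
    ext e
    rw [SimpleGraph.mem_edgeFinset, hp.edgeSet_parentGraph]
    simp
  rw [this, prod_image fun _ _ _ _ h => hp.injective_edge h]

theorem IsParentMap.det_parentMatrix (hp : IsParentMap p) : (parentMatrix R p).det = 1 := by
  obtain ⟨d, hd⟩ := id hp
  have htri : (parentMatrix R p).BlockTriangular fun v : {v // v ≠ r} => OrderDual.toDual (d v) := by
    intro v u hlt
    have hlt : d v < d u := hlt
    have h₁ : (v : V) ≠ u := fun h => by simp [h] at hlt
    have h₂ : p v ≠ u := fun h => by have := hd v; rw [h] at this; omega
    simp [parentMatrix, h₁, h₂]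
  rw [htri.det]
  refine prod_eq_one fun a _ => ?_
  suffices h : (parentMatrix R p).toSquareBlock
      (fun v : {v // v ≠ r} => OrderDual.toDual (d v)) a = 1 by rw [h, Matrix.det_one]
  ext ⟨v, hv⟩ ⟨u, hu⟩
  have hvu : d v = d u := OrderDual.toDual.injective (hv.trans hu.symm)
  have h₂ : p v ≠ u := fun h => by have := hd v; rw [h] at this; omega
  simp [Matrix.toSquareBlock_def, parentMatrix, h₂, Matrix.one_apply, Subtype.ext_iff]

theorem det_parentMatrix_of_not_isParentMap (hp : ¬ IsParentMap p) :
    (parentMatrix R p).det = 0 := by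
  obtain ⟨C, hr, ⟨c, hc⟩, hC⟩ := exists_mem_iff_of_not_isParentMap hp
  let x : {v // v ≠ r} → R := fun v => if (v : V) ∈ C then 1 else 0
  have hsum (y : V) : ∑ u : {v // v ≠ r}, (if y = u then (1 : R) else 0) * x u =
      if y ∈ C then 1 else 0 := by
    by_cases hy : y = r
    · rw [if_neg (hy ▸ hr)]
      exact sum_eq_zero fun u _ => by simp [hy, u.2.symm]
    · rw [sum_eq_single ⟨y, hy⟩]
      · simp [x]
      · intro u _ hu
        have : y ≠ u := fun h => hu (Subtype.ext h.symm)
        simp [this]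
      · simp
  have hx : (parentMatrix R p).mulVec x = 0 := by
    ext v
    simp only [Matrix.mulVec, dotProduct, parentMatrix, sub_mul, sum_sub_distrib, hsum, hC,
      sub_self, Pi.zero_apply]
  have hdet : (parentMatrix R p).det • x = 0 := by
    have := congrArg (parentMatrix R p).adjugate.mulVec hx
    rwa [Matrix.mulVec_mulVec, Matrix.adjugate_mul, Matrix.smul_mulVec, Matrix.one_mulVec,
      Matrix.mulVec_zero] at this
  simpa [x, hc] using congrFun hdet ⟨c, fun h => hr (h ▸ hc)⟩

theorem det_eq_sum_parentMatrix (w : V → V → R) (r : V)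
    (M : Matrix {v // v ≠ r} {v // v ≠ r} R)
    (hM : ∀ v u : {v // v ≠ r},
      M v u = if (v : V) = u then ∑ k ∈ univ.erase (v : V), w v k else - w v u) :
    M.det = ∑ p : {v // v ≠ r} → V, (∏ v : {v // v ≠ r}, w v (p v)) * (parentMatrix R p).det := by
  have hrow : M = fun v : {v // v ≠ r} => ∑ x : V, w v x • fun u : {v // v ≠ r} =>
      ((if (v : V) = u then 1 else 0) - (if x = u then 1 else 0) : R) := by
    ext v u
    rw [hM, Finset.sum_apply]
    simp only [Pi.smul_apply, smul_eq_mul, mul_sub, mul_ite, mul_one, mul_zero,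
      sum_sub_distrib, sum_ite_eq', mem_univ, if_true]
    split_ifs with h
    · rw [← h, ← sum_erase_add univ _ (mem_univ (v : V)), add_sub_cancel_right]
    · simp
  calc M.det = Matrix.detRowAlternating.toMultilinearMap M := rfl
    _ = _ := by
      rw [hrow, MultilinearMap.map_sum]
      refine sum_congr rfl fun p _ => ?_
      rw [MultilinearMap.map_smul_univ]
      rfl

/-- The weighted matrix-tree theorem for an arbitrary symmetric weight on a finite type. -/
theorem det_eq_sum_isTree (w : V → V → R) (hsym : ∀ i j, w i j = w j i) (r : V)
    (M : Matrix {v // v ≠ r} {v // v ≠ r} R)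
    (hM : ∀ v u : {v // v ≠ r},
      M v u = if (v : V) = u then ∑ k ∈ univ.erase (v : V), w v k else - w v u) :
    M.det = ∑ T : SimpleGraph V with T.IsTree,
      ∏ e ∈ T.edgeFinset, Sym2.lift ⟨w, hsym⟩ e := by
  rw [det_eq_sum_parentMatrix w r M hM,
    ← sum_filter_of_ne (p := fun p => IsParentMap p) fun p _ h => by
      by_contra hp
      exact h (by rw [det_parentMatrix_of_not_isParentMap hp, mul_zero])]
  refine sum_bij (fun p _ => parentGraph p) ?_ ?_ ?_ ?_
  · intro p hp
    simpa using (mem_filter.1 hp).2.isTree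
  · intro p hp q hq h
    exact (mem_filter.1 hp).2.eq_of_parentGraph_eq (mem_filter.1 hq).2 h
  · intro T hT
    obtain ⟨p, hp, h⟩ := exists_parentGraph_eq r (mem_filter.1 hT).2
    exact ⟨p, by simpa using hp, h⟩
  · intro p hp
    have hp := (mem_filter.1 hp).2
    rw [hp.det_parentMatrix, mul_one, hp.prod_edgeFinset]
    rfl

end MatrixTree

/-- The weighted matrix-tree theorem: any principal minor of the weighted Laplacian of a
finite simple graph `G` equals the sum over all spanning trees `T ≤ G` of the product of
the weights of the edges of `T`. -/
theorem stmt_3 (n : ℕ) {R : Type*} [CommRing R] (G : SimpleGraph (Fin (n + 1)))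
    (w : Fin (n + 1) → Fin (n + 1) → R) (hsym : ∀ i j, w i j = w j i)
    (hw : ∀ i j, ¬ G.Adj i j → w i j = 0)
    (L : Matrix (Fin (n + 1)) (Fin (n + 1)) R)
    (hL : ∀ i j, L i j = if i = j then ∑ k ∈ univ.erase i, w i k else - w i j)
    (i : Fin (n + 1)) :
    (L.submatrix i.succAbove i.succAbove).det =
      ∑ T : SimpleGraph (Fin (n + 1)),
        if T ≤ G ∧ T.IsTree then ∏ e ∈ T.edgeFinset, Sym2.lift ⟨w, hsym⟩ e else 0 := by
  let M : Matrix {v // v ≠ i} {v // v ≠ i} R := L.submatrix (↑) (↑)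
  have hdet : (L.submatrix i.succAbove i.succAbove).det = M.det :=
    Matrix.det_submatrix_equiv_self (finSuccAboveEquiv i) M
  have hM := MatrixTree.det_eq_sum_isTree w hsym i M fun v u => by
    simp only [M, Matrix.submatrix_apply, hL]
    congr!
  rw [hdet]
  convert hM using 1
  · congr!
  rw [sum_filter]
  refine sum_congr (by congr!) fun T _ => ?_
  by_cases hT : T.IsTree
  · by_cases hle : T ≤ G
    · simp [hT, hle]
    · rw [if_neg fun h => hle h.1, if_pos hT]
      have : ∃ a b, T.Adj a b ∧ ¬ G.Adj a b := by
        by_contra! h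
        exact hle fun a b => h a b
      obtain ⟨a, b, hab, hG⟩ := this
      exact (prod_eq_zero (i := s(a, b)) (by simpa using hab) (hw a b hG)).symm
  · simp [hT]
end

section
/- Let G be a connected finite simple graph on vertex set {1,...,n} with edge weights w_{ij}. Then the external activity polynomial C_G(w) satisfies C_G(w) = ∑_{k=1}^{n} (-1)^{k-1} (k-1)! ∑_{[n] = P_1 ⊔ ... ⊔ P_k} ∏_{{i,j}: ∃s, i,j ∈ P_s} (w_{ij} + 1), where the inner sum is over all set partitions of {1,...,n} into k nonempty blocks, and the product is over all edges of G with both endpoints in the same block. -/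
open Finset
open scoped Classical

/-- The graph `H` joins only vertices lying in a common block of `P`. -/
def RespectsParts {V : Type*} [Fintype V] [DecidableEq V] (H : SimpleGraph V)
    (P : Finpartition (univ : Finset V)) : Prop :=
  ∀ u v, H.Adj u v → v ∈ P.part u

theorem Finpartition.ext_part {V : Type*} [Fintype V] [DecidableEq V]
    {P Q : Finpartition (univ : Finset V)}
    (h : ∀ u, P.part u = Q.part u) : P = Q := by
  have key : ∀ {P Q : Finpartition (univ : Finset V)}, (∀ u, P.part u = Q.part u) →
      ∀ s ∈ P.parts, s ∈ Q.parts := by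
    intro P Q h s hs
    obtain ⟨a, ha⟩ := P.nonempty_of_mem_parts hs
    rw [← P.part_eq_of_mem hs ha, h]
    exact Q.part_mem.2 (mem_univ a)
  ext s
  exact ⟨key h s, key (fun u => (h u).symm) s⟩

theorem Finpartition.ofSetoid_ker_eq_iff {V A : Type*} [Fintype V] [DecidableEq V] (f : V → A)
    (P : Finpartition (univ : Finset V)) :
    Finpartition.ofSetoid (Setoid.ker f) = P ↔ ∀ u v, f u = f v ↔ v ∈ P.part u := by
  constructor
  · rintro rfl u v
    rw [Finpartition.mem_part_ofSetoid_iff_rel, Setoid.ker_def]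
  · intro h
    refine Finpartition.ext_part fun u => ?_
    ext v
    rw [Finpartition.mem_part_ofSetoid_iff_rel, Setoid.ker_def, h]

theorem card_filter_ofSetoid_ker_eq {V A : Type*} [Fintype V] [DecidableEq V] [Fintype A]
    (P : Finpartition (univ : Finset V)) :
    #{f : V → A | Finpartition.ofSetoid (Setoid.ker f) = P} =
      (Fintype.card A).descFactorial #P.parts := by
  have hmem (v : V) : P.part v ∈ P.parts := P.part_mem.2 (mem_univ v)
  rw [← Fintype.card_coe P.parts, ← Fintype.card_embedding_eq, ← Finset.card_univ]
  symm
  refine Finset.card_bij (fun g _ v => g ⟨P.part v, hmem v⟩) ?_ ?_ ?_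
  · intro g _
    rw [mem_filter, Finpartition.ofSetoid_ker_eq_iff]
    refine ⟨mem_univ _, fun u v => ?_⟩
    rw [g.injective.eq_iff, Subtype.mk.injEq,
      P.mem_part_iff_part_eq_part (mem_univ v) (mem_univ u), eq_comm]
  · intro g _ g' _ h
    ext ⟨s, hs⟩
    obtain ⟨a, ha⟩ := P.nonempty_of_mem_parts hs
    have := congrFun h a
    simp only [P.part_eq_of_mem hs ha] at this
    rw [this]
  · intro f hf
    rw [mem_filter, Finpartition.ofSetoid_ker_eq_iff] at hf
    choose a ha using fun s : P.parts => P.nonempty_of_mem_parts s.2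
    refine ⟨⟨fun s => f (a s), fun s t hst => ?_⟩, mem_univ _, ?_⟩
    · have h := (hf.2 _ _).1 hst
      rw [P.part_eq_of_mem s.2 (ha s)] at h
      exact Subtype.ext (P.eq_of_mem_parts s.2 t.2 h (ha t))
    · funext v
      have h := ha ⟨P.part v, hmem v⟩
      exact ((hf.2 _ _).2 h).symm

/-- Functions constant along the edges of `H` are functions on the connected components. -/
theorem card_filter_adj_imp_eq {V A : Type*} [Fintype V] [DecidableEq V] [Fintype A]
    (H : SimpleGraph V) :
    #{f : V → A | ∀ u v, H.Adj u v → f u = f v} =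
      Fintype.card A ^ Fintype.card H.ConnectedComponent := by
  rw [← Fintype.card_fun, ← Finset.card_univ]
  symm
  refine Finset.card_bij (fun g _ v => g (H.connectedComponentMk v)) ?_ ?_ ?_
  · intro g _
    rw [mem_filter]
    exact ⟨mem_univ _, fun u v h => congrArg g (SimpleGraph.ConnectedComponent.sound h.reachable)⟩
  · intro g _ g' _ h
    funext c
    induction c using SimpleGraph.ConnectedComponent.ind with
    | h v => exact congrFun h v
  · intro f hf
    rw [mem_filter] at hf
    have hwalk : ∀ u v (p : H.Walk u v), f u = f v := by
      intro u v p
      induction p with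
      | nil => rfl
      | cons h _ ih => exact (hf.2 _ _ h).trans ih
    exact ⟨SimpleGraph.ConnectedComponent.lift f fun u v p _ => hwalk u v p, mem_univ _, rfl⟩

theorem sum_descFactorial_card_parts {V : Type*} (A : Type*) [Fintype V] [DecidableEq V] [Fintype A]
    (H : SimpleGraph V) :
    ∑ P : Finpartition (univ : Finset V) with RespectsParts H P,
      (Fintype.card A).descFactorial #P.parts =
      Fintype.card A ^ Fintype.card H.ConnectedComponent := by
  rw [← card_filter_adj_imp_eq H, Finset.card_eq_sum_card_fiberwise
    (f := fun f : V → A => Finpartition.ofSetoid (Setoid.ker f))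
    (t := univ.filter (RespectsParts H))]
  · refine sum_congr rfl fun P hP => ?_
    rw [mem_filter] at hP
    rw [← card_filter_ofSetoid_ker_eq P, filter_filter]
    congr 1
    refine filter_congr fun f _ => ?_
    rw [Finpartition.ofSetoid_ker_eq_iff]
    exact ⟨fun h => ⟨fun u v huv => (h u v).2 (hP.2 u v huv), h⟩, fun h => h.2⟩
  · intro f hf
    rw [mem_coe, mem_filter] at hf ⊢
    refine ⟨mem_univ _, fun u v huv => ?_⟩
    rw [Finpartition.mem_part_ofSetoid_iff_rel]
    exact hf.2 u v huv

theorem descPochhammer_eval_neg_one (k : ℕ) :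
    (descPochhammer ℤ k).eval (-1) = (-1) ^ k * (k.factorial : ℤ) := by
  induction k with
  | zero => simp
  | succ k ih =>
    rw [descPochhammer_succ_eval, ih, Nat.factorial_succ]
    push_cast
    ring

theorem descPochhammer_coeff_one {k : ℕ} (hk : k ≠ 0) :
    (descPochhammer ℤ k).coeff 1 = (-1) ^ (k - 1) * ((k - 1).factorial : ℤ) := by
  obtain ⟨k, rfl⟩ := Nat.exists_eq_succ_of_ne_zero hk
  rw [descPochhammer_succ_left, ← zero_add 1, Polynomial.coeff_X_mul,
    Polynomial.coeff_zero_eq_eval_zero, Polynomial.eval_comp]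
  simp [descPochhammer_eval_neg_one]

theorem sum_descPochhammer_card_parts {V : Type*} [Fintype V] [DecidableEq V] (H : SimpleGraph V) :
    ∑ P : Finpartition (univ : Finset V) with RespectsParts H P, descPochhammer ℤ #P.parts =
      Polynomial.X ^ Fintype.card H.ConnectedComponent := by
  refine Polynomial.eq_of_infinite_eval_eq _ _ <|
    (Set.infinite_range_of_injective (Nat.cast_injective (R := ℤ))).mono ?_
  rintro _ ⟨x, rfl⟩
  have h := sum_descFactorial_card_parts (Fin x) H
  rw [Fintype.card_fin] at h
  simp only [Set.mem_ofPred_eq, Polynomial.eval_finsetSum, Polynomial.eval_pow, Polynomial.eval_X,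
    descPochhammer_eval_eq_descFactorial]
  exact_mod_cast h

theorem card_connectedComponent_eq_one_iff {V : Type*} (H : SimpleGraph V)
    [Fintype H.ConnectedComponent] :
    Fintype.card H.ConnectedComponent = 1 ↔ H.Connected := by
  rw [Fintype.card_eq_one_iff_nonempty_unique, SimpleGraph.connected_iff]
  constructor
  · rintro ⟨_⟩
    exact ⟨fun u v => SimpleGraph.ConnectedComponent.exact (Subsingleton.elim _ _),
      (default : H.ConnectedComponent).nonempty_supp.to_type⟩
  · rintro ⟨hp, ⟨v⟩⟩
    have := hp.subsingleton_connectedComponent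
    exact ⟨⟨⟨H.connectedComponentMk v⟩, fun _ => Subsingleton.elim _ _⟩⟩

theorem Finpartition.parts_card_ne_zero {V : Type*} [Fintype V] [DecidableEq V] [Nonempty V]
    (P : Finpartition (univ : Finset V)) : #P.parts ≠ 0 :=
  Finset.card_ne_zero_of_mem (P.part_mem.2 (mem_univ (Classical.arbitrary V)))

/-- The partition-lattice Möbius sum over the partitions coarser than the components of `H`. -/
theorem sum_neg_one_pow_mul_factorial {V R : Type*} [Fintype V] [DecidableEq V] [Nonempty V]
    [CommRing R]
    (H : SimpleGraph V) :
    ∑ P : Finpartition (univ : Finset V) with RespectsParts H P,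
      (-1 : R) ^ (#P.parts - 1) * ((#P.parts - 1).factorial : R) =
      if H.Connected then 1 else 0 := by
  have h := congrArg (fun p => ((p.coeff 1 : ℤ) : R)) (sum_descPochhammer_card_parts H)
  simp only [Polynomial.finsetSum_coeff, Polynomial.coeff_X_pow, @eq_comm _ 1,
    card_connectedComponent_eq_one_iff,
    descPochhammer_coeff_one (Finpartition.parts_card_ne_zero _)] at h
  push_cast at h
  exact h

theorem SimpleGraph.edgeFinset_sup_fromEdgeSet_coe {V : Type*} [DecidableEq V] (T : SimpleGraph V)
    (t : Finset (Sym2 V)) {_ : Fintype T.edgeSet}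
    {_ : Fintype (T ⊔ fromEdgeSet (t : Set (Sym2 V))).edgeSet}
    (ht : ∀ e ∈ t, ¬ e.IsDiag) :
    (T ⊔ fromEdgeSet (t : Set (Sym2 V))).edgeFinset = T.edgeFinset ∪ t := by
  ext e
  simp only [mem_edgeFinset, edgeSet_sup, edgeSet_fromEdgeSet, Set.mem_union, Set.mem_sdiff,
    mem_coe, mem_union]
  exact or_congr Iff.rfl ⟨fun h => h.1, fun h => ⟨h, ht e h⟩⟩

theorem SimpleGraph.edgeFinset_sup_fromEdgeSet_singleton {V : Type*} [DecidableEq V]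
    (T : SimpleGraph V)
    (e : Sym2 V) {_ : Fintype T.edgeSet}
    {_ : Fintype (T ⊔ fromEdgeSet {e}).edgeSet} (he : ¬ e.IsDiag) :
    (T ⊔ fromEdgeSet {e}).edgeFinset = insert e T.edgeFinset := by
  ext e'
  simp only [mem_edgeFinset, edgeSet_sup, edgeSet_fromEdgeSet, Set.mem_union, Set.mem_sdiff,
    Set.mem_singleton_iff, mem_insert]
  rw [or_comm]
  exact or_congr_left ⟨fun h => h.1, fun h => ⟨h, h ▸ he⟩⟩

theorem prod_mul_prod_add_one_eq_sum {V R : Type*} [Fintype V] [DecidableEq V]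
    [CommRing R] (T : SimpleGraph V)
    (s : Finset (Sym2 V)) (hs : ∀ e ∈ s, ¬ e.IsDiag) (hd : Disjoint T.edgeFinset s)
    (f : Sym2 V → R) :
    (∏ e ∈ T.edgeFinset, f e) * ∏ e ∈ s, (f e + 1) =
      ∑ H : SimpleGraph V with T ≤ H ∧ H.edgeFinset \ T.edgeFinset ⊆ s,
        ∏ e ∈ H.edgeFinset, f e := by
  rw [Finset.prod_add_one, mul_sum]
  refine Finset.sum_bij' (fun t _ => T ⊔ SimpleGraph.fromEdgeSet (t : Set (Sym2 V)))
    (fun H _ => H.edgeFinset \ T.edgeFinset) ?_ ?_ ?_ ?_ ?_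
  · intro t ht
    rw [mem_powerset] at ht
    rw [mem_filter, SimpleGraph.edgeFinset_sup_fromEdgeSet_coe _ _ fun e he => hs e (ht he)]
    exact ⟨mem_univ _, le_sup_left, by rw [union_sdiff_left]; exact sdiff_subset.trans ht⟩
  · intro H hH
    rw [mem_filter] at hH
    exact mem_powerset.2 hH.2.2
  · intro t ht
    rw [mem_powerset] at ht
    rw [SimpleGraph.edgeFinset_sup_fromEdgeSet_coe _ _ fun e he => hs e (ht he), union_sdiff_left]
    exact sdiff_eq_self_of_disjoint (hd.mono_right ht).symm
  · intro H hH
    rw [mem_filter] at hH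
    rw [← SimpleGraph.edgeFinset_inj, SimpleGraph.edgeFinset_sup_fromEdgeSet_coe _ _
      fun e he => hs e (hH.2.2 he)]
    exact union_sdiff_of_subset (SimpleGraph.edgeFinset_mono hH.2.1)
  · intro t ht
    rw [mem_powerset] at ht
    rw [SimpleGraph.edgeFinset_sup_fromEdgeSet_coe _ _ fun e he => hs e (ht he),
      prod_union (hd.mono_right ht)]

/-- The non-tree edge `e` is `ν`-minimal on the cycle it closes with `T`. -/
def IsExternallyActive {V : Type*} (ν : Sym2 V → ℕ) (T : SimpleGraph V)
    (e : Sym2 V) : Prop :=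
  ∀ f ∈ (T ⊔ SimpleGraph.fromEdgeSet {e}).edgeSet,
    ¬ (T ⊔ SimpleGraph.fromEdgeSet {e}).IsBridge f → ν e ≤ ν f

theorem exists_isTree_isExternallyActive {V : Type*} [Fintype V] [DecidableEq V] (ν : Sym2 V → ℕ)
    {H : SimpleGraph V} (hH : H.Connected) :
    ∃ T ≤ H, T.IsTree ∧ ∀ e ∈ H.edgeFinset \ T.edgeFinset, IsExternallyActive ν T e := by
  obtain ⟨T₀, hT₀, hT₀'⟩ := hH.exists_isTree_le
  obtain ⟨T, hT, hmax⟩ := Finset.exists_max_image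
    (univ.filter fun T : SimpleGraph V => T ≤ H ∧ T.IsTree) (fun T => ∑ e ∈ T.edgeFinset, ν e)
    ⟨T₀, by simp [hT₀, hT₀']⟩
  rw [mem_filter] at hT
  obtain ⟨-, hle, htree⟩ := hT
  refine ⟨T, hle, htree, fun e he f hf hbr => ?_⟩
  by_contra! hlt
  rw [mem_sdiff] at he
  obtain ⟨S, hSdef⟩ : ∃ S, S = T ⊔ SimpleGraph.fromEdgeSet {e} := ⟨_, rfl⟩
  rw [← hSdef] at hf hbr
  have hS : S.edgeFinset = insert e T.edgeFinset := by
    subst hSdef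
    exact T.edgeFinset_sup_fromEdgeSet_singleton e
      (H.not_isDiag_of_mem_edgeSet (SimpleGraph.mem_edgeFinset.1 he.1))
  have hSconn : S.Connected := htree.connected.mono (hSdef ▸ le_sup_left)
  have hconn : (S.deleteEdges {f}).Connected := by
    induction f with
    | h x y => exact hSconn.connected_delete_edge_of_not_isBridge hbr
  have hE {_ : Fintype (S.deleteEdges {f}).edgeSet} :
      (S.deleteEdges {f}).edgeFinset = S.edgeFinset.erase f := by
    ext g
    simp [SimpleGraph.edgeSet_deleteEdges, and_comm]
  have hcardS : #S.edgeFinset = #T.edgeFinset + 1 := by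
    rw [hS, card_insert_of_notMem he.2]
  have htree' : (S.deleteEdges {f}).IsTree := by
    rw [SimpleGraph.isTree_iff_connected_and_card]
    refine ⟨hconn, ?_⟩
    have := htree.card_edgeFinset
    rw [← SimpleGraph.coe_edgeFinset, Nat.card_coe_set_eq, Set.ncard_coe_finset, hE,
      card_erase_of_mem (SimpleGraph.mem_edgeFinset.2 hf), Nat.card_eq_fintype_card]
    omega
  have hSle : S ≤ H := by
    rw [← SimpleGraph.edgeFinset_subset_edgeFinset, hS]
    exact insert_subset he.1 (SimpleGraph.edgeFinset_mono hle)
  have := hmax (S.deleteEdges {f}) (by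
    rw [mem_filter]
    exact ⟨mem_univ _, (SimpleGraph.deleteEdges_le _).trans hSle, htree'⟩)
  have h1 := Finset.add_sum_erase S.edgeFinset ν (SimpleGraph.mem_edgeFinset.2 hf)
  have h2 : ∑ g ∈ S.edgeFinset, ν g = ν e + ∑ g ∈ T.edgeFinset, ν g := by
    rw [hS, sum_insert he.2]
  rw [hE] at this
  omega

theorem exists_mem_cycle_notMem_edgeFinset {V : Type*} [Fintype V] [DecidableEq V]
    {T T' : SimpleGraph V}
    (hT : T.IsAcyclic) (hT' : T'.Connected) {e : Sym2 V} (he : e ∈ T.edgeFinset)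
    (he' : e ∉ T'.edgeFinset) :
    ∃ f ∈ T'.edgeFinset, f ∉ T.edgeFinset ∧ ¬ (T' ⊔ SimpleGraph.fromEdgeSet {e}).IsBridge f := by
  by_contra! hcon
  induction e with
  | h x y =>
  have hxy : x ≠ y := by
    rintro rfl
    simp at he
  set S := T' ⊔ SimpleGraph.fromEdgeSet {s(x, y)} with hS
  have hbr : ¬ S.IsBridge s(x, y) := by
    rw [SimpleGraph.isBridge_iff, not_not]
    refine (hT'.preconnected x y).mono fun a b hab => ?_
    rw [SimpleGraph.deleteEdges_adj]
    refine ⟨Or.inl hab, fun h => he' ?_⟩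
    rw [Set.mem_singleton_iff] at h
    rw [← h]
    simpa using hab
  rw [SimpleGraph.isBridge_iff_forall_cycle_notMem
    (SimpleGraph.edgeSet_mono le_sup_right (by simpa using hxy))] at hbr
  push Not at hbr
  obtain ⟨u, p, hp, hmem⟩ := hbr
  refine hT (p.transfer T fun g hg => ?_) (hp.transfer _)
  have hgS := p.edges_subset_edgeSet hg
  by_cases hgT : g ∈ T'.edgeFinset
  · by_contra hgT'
    exact (hcon g hgT (by simpa using hgT')).notMem_edges_of_isCycle hp hg
  · rw [SimpleGraph.edgeSet_sup, SimpleGraph.edgeSet_fromEdgeSet] at hgS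
    rcases hgS with h | h
    · exact absurd (SimpleGraph.mem_edgeFinset.2 h) hgT
    · have := h.1
      rw [Set.mem_singleton_iff] at this
      rw [this]
      exact SimpleGraph.mem_edgeFinset.1 he

theorem eq_of_isTree_of_isExternallyActive {V : Type*} [Fintype V] [DecidableEq V] {ν : Sym2 V → ℕ}
    (hν : Function.Injective ν) {H T T' : SimpleGraph V} (hTH : T ≤ H) (hTH' : T' ≤ H)
    (hT : T.IsTree) (hT' : T'.IsTree)
    (ha : ∀ e ∈ H.edgeFinset \ T.edgeFinset, IsExternallyActive ν T e)
    (ha' : ∀ e ∈ H.edgeFinset \ T'.edgeFinset, IsExternallyActive ν T' e) : T = T' := by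
  by_contra hne
  have hnonempty : (symmDiff T.edgeFinset T'.edgeFinset).Nonempty := by
    rw [nonempty_iff_ne_empty, Ne, ← bot_eq_empty, symmDiff_eq_bot, SimpleGraph.edgeFinset_inj]
    exact hne
  obtain ⟨e, he, hmax⟩ := Finset.exists_max_image _ ν hnonempty
  have key : ∀ {A B : SimpleGraph V}, A ≤ H → A.IsTree → B.IsTree →
      (∀ e ∈ H.edgeFinset \ B.edgeFinset, IsExternallyActive ν B e) →
      (∀ f ∈ symmDiff A.edgeFinset B.edgeFinset, ν f ≤ ν e) →
      e ∈ A.edgeFinset → e ∉ B.edgeFinset → False := by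
    intro A B hAH hA hB hact hmax heA heB
    obtain ⟨f, hfB, hfA, hbr⟩ :=
      exists_mem_cycle_notMem_edgeFinset hA.isAcyclic hB.connected heA heB
    have h1 := hact e (mem_sdiff.2 ⟨SimpleGraph.edgeFinset_mono hAH heA, heB⟩) f
      (SimpleGraph.edgeSet_mono le_sup_left (SimpleGraph.mem_edgeFinset.1 hfB)) hbr
    have h2 := hmax f (mem_symmDiff.2 (Or.inr ⟨hfB, hfA⟩))
    rw [hν (le_antisymm h1 h2)] at heB
    exact heB hfB
  rcases mem_symmDiff.1 he with h | h
  · exact key hTH hT hT' ha' hmax h.1 h.2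
  · exact key hTH' hT' hT ha (by rwa [symmDiff_comm]) h.1 h.2

theorem card_filter_isTree_isExternallyActive {V : Type*} [Fintype V] [DecidableEq V]
    {ν : Sym2 V → ℕ}
    (hν : Function.Injective ν) (H : SimpleGraph V) :
    #{T : SimpleGraph V | T ≤ H ∧ T.IsTree ∧
      ∀ e ∈ H.edgeFinset \ T.edgeFinset, IsExternallyActive ν T e} =
      if H.Connected then 1 else 0 := by
  split_ifs with hH
  · obtain ⟨T, h1, h2, h3⟩ := exists_isTree_isExternallyActive ν hH
    rw [card_eq_one]
    refine ⟨T, eq_singleton_iff_unique_mem.2 ⟨by simpa using ⟨h1, h2, by simpa using h3⟩, ?_⟩⟩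
    intro T' hT'
    rw [mem_filter] at hT'
    obtain ⟨-, h1', h2', h3'⟩ := hT'
    exact eq_of_isTree_of_isExternallyActive hν h1' h1 h2' h2 h3' h3
  · rw [card_eq_zero, filter_eq_empty_iff]
    rintro T - ⟨h1, h2, -⟩
    exact hH (h2.connected.mono h1)

theorem sum_isTree_eq_sum_connected {V R : Type*} [Fintype V] [DecidableEq V]
    [CommRing R] (G : SimpleGraph V)
    (f : Sym2 V → R) {ν : Sym2 V → ℕ} (hν : Function.Injective ν) :
    (∑ T : SimpleGraph V, if T ≤ G ∧ T.IsTree then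
      (∏ e ∈ T.edgeFinset, f e) *
        ∏ e ∈ (G.edgeFinset \ T.edgeFinset).filter (IsExternallyActive ν T), (f e + 1) else 0) =
    ∑ H : SimpleGraph V with H ≤ G ∧ H.Connected, ∏ e ∈ H.edgeFinset, f e := by
  have hT (T : SimpleGraph V) : (if T ≤ G ∧ T.IsTree then
      (∏ e ∈ T.edgeFinset, f e) *
        ∏ e ∈ (G.edgeFinset \ T.edgeFinset).filter (IsExternallyActive ν T), (f e + 1) else 0) =
      ∑ H : SimpleGraph V, if H ≤ G ∧ T ≤ H ∧ T.IsTree ∧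
        ∀ e ∈ H.edgeFinset \ T.edgeFinset, IsExternallyActive ν T e then
          ∏ e ∈ H.edgeFinset, f e else 0 := by
    split_ifs with h
    · rw [prod_mul_prod_add_one_eq_sum, ← sum_filter]
      · refine sum_congr (filter_congr fun H _ => ?_) fun _ _ => rfl
        constructor
        · rintro ⟨hTH, hs⟩
          refine ⟨?_, hTH, h.2, fun e he => (mem_filter.1 (hs he)).2⟩
          rw [← SimpleGraph.edgeFinset_subset_edgeFinset]
          intro e he
          by_cases heT : e ∈ T.edgeFinset
          · exact SimpleGraph.edgeFinset_mono h.1 heT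
          · exact (mem_sdiff.1 (mem_filter.1 (hs (mem_sdiff.2 ⟨he, heT⟩))).1).1
        · rintro ⟨hHG, hTH, -, ha⟩
          exact ⟨hTH, fun e he => mem_filter.2
            ⟨sdiff_subset_sdiff (SimpleGraph.edgeFinset_mono hHG) subset_rfl he, ha e he⟩⟩
      · intro e he
        exact G.not_isDiag_of_mem_edgeSet
          (SimpleGraph.mem_edgeFinset.1 (mem_sdiff.1 (mem_filter.1 he).1).1)
      · exact disjoint_sdiff.mono_right (filter_subset _ _)
    · refine (sum_eq_zero fun H _ => if_neg ?_).symm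
      rintro ⟨h1, h2, h3, -⟩
      exact h ⟨h2.trans h1, h3⟩
  rw [sum_congr rfl fun T _ => hT T, sum_comm, sum_filter]
  refine sum_congr rfl fun H _ => ?_
  by_cases hHG : H ≤ G
  · simp only [hHG, true_and]
    rw [← sum_filter, sum_const, card_filter_isTree_isExternallyActive hν]
    split_ifs <;> simp
  · simp [hHG]

theorem prod_filter_parts_eq_sum {V R : Type*} [Fintype V] [DecidableEq V]
    [CommRing R] (G : SimpleGraph V)
    (f : Sym2 V → R) (P : Finpartition (univ : Finset V)) :
    ∏ e ∈ G.edgeFinset.filter (fun e => ∃ b ∈ P.parts, ∀ v ∈ e, v ∈ b), (f e + 1) =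
      ∑ H : SimpleGraph V with H ≤ G ∧ RespectsParts H P, ∏ e ∈ H.edgeFinset, f e := by
  have hbot : ∀ {_ : Fintype (⊥ : SimpleGraph V).edgeSet},
      (⊥ : SimpleGraph V).edgeFinset = ∅ := by simp [← coe_inj]
  have h := prod_mul_prod_add_one_eq_sum (⊥ : SimpleGraph V)
    (G.edgeFinset.filter (fun e => ∃ b ∈ P.parts, ∀ v ∈ e, v ∈ b))
    (fun e he => G.not_isDiag_of_mem_edgeSet (SimpleGraph.mem_edgeFinset.1 (mem_filter.1 he).1))
    (by rw [hbot]; exact disjoint_empty_left _) f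
  simp only [hbot, prod_empty, one_mul, bot_le, true_and, sdiff_empty] at h
  rw [h]
  refine sum_congr (filter_congr fun H _ => ?_) fun _ _ => rfl
  constructor
  · intro hs
    refine ⟨SimpleGraph.edgeFinset_subset_edgeFinset.1 (hs.trans (filter_subset _ _)), ?_⟩
    intro u v huv
    obtain ⟨b, hb, hbv⟩ :=
      (mem_filter.1 (hs (SimpleGraph.mem_edgeFinset.2 (H.mem_edgeSet.2 huv)))).2
    rw [P.part_eq_of_mem hb (hbv u (Sym2.mem_mk_left u v))]
    exact hbv v (Sym2.mem_mk_right u v)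
  · rintro ⟨hHG, hP⟩ e he
    refine mem_filter.2 ⟨SimpleGraph.edgeFinset_mono hHG he, ?_⟩
    induction e with
    | h u v =>
      refine ⟨P.part u, P.part_mem.2 (mem_univ u), fun a ha => ?_⟩
      rcases Sym2.mem_iff.1 ha with rfl | rfl
      · exact P.mem_part_self.2 (mem_univ _)
      · exact hP _ _ (SimpleGraph.mem_edgeFinset.1 he)

/-- Theorem on the external activity polynomial: for a connected finite simple graph `G` on
`{1, …, n}` with edge weights, `C_G(w)` equals the alternating sum, over set partitions of
the vertex set into `k` nonempty blocks, of `(-1)^(k-1) (k-1)!` times the product of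
`w_e + 1` over the edges `e` of `G` whose two endpoints lie in a common block. The linear
order on the edges is given by an injective numbering `ν`; an edge `e ∉ T` is externally
active for a spanning tree `T` when it is `ν`-minimal among the edges of the unique cycle
of `T ∪ {e}` (the non-bridge edges of `T ∪ {e}`). -/
theorem stmt_10 (n : ℕ) {R : Type*} [CommRing R] (G : SimpleGraph (Fin n))
    (hG : G.Connected) (w : Fin n → Fin n → R) (hsym : ∀ i j, w i j = w j i)
    (ν : Sym2 (Fin n) → ℕ) (hν : Function.Injective ν) :
    (∑ T : SimpleGraph (Fin n),
      if T ≤ G ∧ T.IsTree then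
        (∏ e ∈ T.edgeFinset, Sym2.lift ⟨w, hsym⟩ e) *
          ∏ e ∈ (G.edgeFinset \ T.edgeFinset).filter (fun e =>
              ∀ f ∈ (T ⊔ SimpleGraph.fromEdgeSet {e}).edgeFinset,
                ¬ (T ⊔ SimpleGraph.fromEdgeSet {e}).IsBridge f → ν e ≤ ν f),
            (Sym2.lift ⟨w, hsym⟩ e + 1)
      else 0) =
    ∑ k ∈ Icc 1 n, (-1 : R) ^ (k - 1) * ((k - 1).factorial : R) *
      ∑ P : Finpartition (univ : Finset (Fin n)),
        if P.parts.card = k then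
          ∏ e ∈ G.edgeFinset.filter (fun e => ∃ b ∈ P.parts, ∀ v ∈ e, v ∈ b),
            (Sym2.lift ⟨w, hsym⟩ e + 1)
        else 0 := by
  have := hG.nonempty
  have htrees := sum_isTree_eq_sum_connected G (Sym2.lift ⟨w, hsym⟩) hν
  unfold IsExternallyActive at htrees
  simp only [← SimpleGraph.mem_edgeFinset] at htrees
  refine Eq.trans (by convert htrees) ?_
  have hmem (P : Finpartition (univ : Finset (Fin n))) : #P.parts ∈ Icc 1 n :=
    mem_Icc.2 ⟨Nat.one_le_iff_ne_zero.2 P.parts_card_ne_zero, by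
      simpa using P.card_parts_le_card⟩
  have hprod (P : Finpartition (univ : Finset (Fin n))) :
      ∏ e ∈ G.edgeFinset.filter (fun e => ∃ b ∈ P.parts, ∀ v ∈ e, v ∈ b),
          (Sym2.lift ⟨w, hsym⟩ e + 1) =
        ∑ H : SimpleGraph (Fin n) with H ≤ G ∧ RespectsParts H P,
          ∏ e ∈ H.edgeFinset, Sym2.lift ⟨w, hsym⟩ e := by
    convert prod_filter_parts_eq_sum G (Sym2.lift ⟨w, hsym⟩) P
  simp_rw [hprod, mul_sum, mul_ite, mul_zero]
  rw [sum_comm]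
  simp_rw [sum_ite_eq, hmem, if_true, mul_sum, sum_filter]
  rw [sum_comm]
  refine sum_congr rfl fun H _ => ?_
  by_cases hHG : H ≤ G
  · simp only [hHG, true_and]
    rw [← sum_filter, ← sum_mul, sum_neg_one_pow_mul_factorial, ite_mul, one_mul, zero_mul]
  · simp [hHG]
end

section
/- Let G be a finite simple graph on {1,...,n} with edge weights, L_G its Laplacian, and J = {(i_1,j_1),...,(i_m,j_m)} ⊂ {1,...,n}² a component-disjoint set (all i_p distinct and all j_p distinct). Then (-1)^{ΣJ} det(L_G(J)) = ∑_F ε(τ_J ∘ γ_{F,J}) w(F), where L_G(J) is obtained from L_G by deleting rows i_1,...,i_m and columns j_1,...,j_m, ΣJ = ∑_p(i_p + j_p), and the sum is over all J-admissible spanning forests F of G, i.e. forests with exactly m components, each containing exactly one vertex from {i_1,...,i_m} and one from {j_1,...,j_m}; γ_{F,J} is the permutation of {1,...,m} with i_p and j_{γ_{F,J}(p)} in the same component, and τ_J is the permutation sorting the j's when the pairs are ordered by increasing i. -/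
open Finset
open scoped Classical

/-- `f` fixes every element of `S`, and every orbit of `f` ends in `S`: the map `f` is the parent
map of a rooted forest whose set of roots is `S`. -/
def IsParentMap {V : Type*} (S : Set V) (f : V → V) : Prop :=
  (∀ a ∈ S, f a = a) ∧ ∀ a, ∃ k, f^[k] a ∈ S

/-- The simple graph joining every vertex to its image under `f`. -/
def parentGraph {V : Type*} (f : V → V) : SimpleGraph V :=
  SimpleGraph.fromRel fun a b => f a = b

section ParentMap

variable {V : Type*} {S : Set V} {f : V → V}

theorem parentGraph_adj {a b : V} :
    (parentGraph f).Adj a b ↔ a ≠ b ∧ (f a = b ∨ f b = a) :=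
  SimpleGraph.fromRel_adj _ _ _

theorem iterate_eq_self_of_fixed (hS : ∀ a ∈ S, f a = a) {a : V} (ha : a ∈ S) (k : ℕ) :
    f^[k] a = a :=
  Function.iterate_fixed (hS a ha) k

theorem iterate_eq_of_le (hS : ∀ a ∈ S, f a = a) {a : V} {k l : ℕ} (h : f^[k] a ∈ S)
    (hkl : k ≤ l) : f^[l] a = f^[k] a := by
  obtain ⟨d, rfl⟩ := Nat.exists_eq_add_of_le hkl
  rw [add_comm, Function.iterate_add_apply, iterate_eq_self_of_fixed hS h]

theorem IsParentMap.notMem_periodicPts (hf : IsParentMap S f) {a : V} (ha : a ∉ S) :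
    a ∉ Function.periodicPts f := by
  rintro ⟨k, hk, hp⟩
  obtain ⟨l, hl⟩ := hf.2 a
  have h1 : f^[k * l] a = a := hp.mul_const l
  have h2 := iterate_eq_of_le hf.1 hl (Nat.le_mul_of_pos_left l hk)
  rw [h1] at h2
  exact ha (h2 ▸ hl)

theorem IsParentMap.exists_iterate_mem [Finite V] (hf : IsParentMap S f) :
    ∃ N, ∀ a, f^[N] a ∈ S := by
  have := Fintype.ofFinite V
  choose k hk using hf.2
  refine ⟨∑ a, k a, fun a => ?_⟩
  rw [iterate_eq_of_le hf.1 (hk a) (Finset.single_le_sum (fun _ _ => Nat.zero_le _) (mem_univ a))]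
  exact hk a

theorem parentGraph_reachable_iterate (a : V) (k : ℕ) :
    (parentGraph f).Reachable a (f^[k] a) := by
  induction k with
  | zero => exact SimpleGraph.Reachable.refl _
  | succ k ih =>
    refine ih.trans ?_
    rw [Function.iterate_succ_apply']
    by_cases h : f^[k] a = f (f^[k] a)
    · rw [← h]
    · exact SimpleGraph.Adj.reachable (parentGraph_adj.2 ⟨h, Or.inl rfl⟩)

/-- In a graph, a property preserved by adjacency is preserved by reachability. -/
theorem SimpleGraph.Reachable.prop_of_adj {G : SimpleGraph V} {P : V → Prop}
    (hP : ∀ a b, G.Adj a b → P a → P b) {a b : V} (h : G.Reachable a b) (ha : P a) : P b := by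
  obtain ⟨p⟩ := h
  induction p with
  | nil => exact ha
  | cons hadj _ ih => exact ih (hP _ _ hadj ha)

theorem parentGraph_reachable_iff (hS : ∀ a ∈ S, f a = a) {r : V} (hr : r ∈ S) {a : V} :
    (parentGraph f).Reachable r a ↔ ∃ k, f^[k] a = r := by
  constructor
  · intro h
    refine h.prop_of_adj (P := fun a => ∃ k, f^[k] a = r) ?_ ⟨0, rfl⟩
    rintro a b hab ⟨k, hk⟩
    obtain ⟨-, rfl | rfl⟩ := parentGraph_adj.1 hab
    · refine ⟨k, ?_⟩
      rw [← Function.iterate_succ_apply, Function.iterate_succ_apply', hk, hS r hr]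
    · exact ⟨k + 1, hk⟩
  · rintro ⟨k, rfl⟩
    exact (parentGraph_reachable_iterate a k).symm

theorem IsParentMap.isAcyclic (hf : IsParentMap S f) : (parentGraph f).IsAcyclic := by
  have key : ∀ a, a ≠ f a → (parentGraph f).IsBridge s(a, f a) := by
    intro a ha h
    have haS : a ∉ S := fun h => ha (hf.1 a h).symm
    obtain ⟨k, hk⟩ := h.prop_of_adj (P := fun v => ∃ k, f^[k] v = a) (by
      rintro u v huv ⟨k, hk⟩
      rw [SimpleGraph.deleteEdges_adj, parentGraph_adj] at huv
      obtain ⟨⟨-, rfl | rfl⟩, h2⟩ := huv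
      · rcases k with _ | k
        · simp only [Function.iterate_zero, id] at hk
          simp [hk] at h2
        · exact ⟨k, hk⟩
      · exact ⟨k + 1, hk⟩) ⟨0, rfl⟩
    exact hf.notMem_periodicPts haS ⟨k + 1, k.succ_pos, hk⟩
  rw [SimpleGraph.isAcyclic_iff_forall_adj_isBridge]
  intro a b hab
  obtain ⟨hne, rfl | rfl⟩ := parentGraph_adj.1 hab
  · exact key a hne
  · rw [Sym2.eq_swap]
    exact key b hne.symm

theorem parentGraph_injOn : Set.InjOn parentGraph {f : V → V | IsParentMap S f} := by
  intro f hf g hg hfg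
  have key : ∀ k a, f^[k] a ∈ S → f a = g a := by
    intro k
    induction k with
    | zero => intro a ha; rw [hf.1 a ha, hg.1 a ha]
    | succ k ih =>
      intro a ha
      by_cases haS : a ∈ S
      · rw [hf.1 a haS, hg.1 a haS]
      have hne : a ≠ f a := fun h => hf.notMem_periodicPts haS ⟨1, one_pos, h.symm⟩
      have hadj : (parentGraph f).Adj a (f a) := parentGraph_adj.2 ⟨hne, Or.inl rfl⟩
      rw [hfg, parentGraph_adj] at hadj
      obtain ⟨-, h | h⟩ := hadj
      · exact h.symm
      · rw [← ih (f a) ha] at h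
        exact absurd ⟨2, two_pos, h⟩ (hf.notMem_periodicPts haS)
  funext a
  obtain ⟨k, hk⟩ := hf.2 a
  exact key k a hk

theorem SimpleGraph.Reachable.exists_adj_dist_lt {G : SimpleGraph V} {a c : V}
    (h : G.Reachable a c) (hne : a ≠ c) : ∃ b, G.Adj a b ∧ G.dist b c < G.dist a c := by
  obtain ⟨p, hp⟩ := h.exists_walk_length_eq_dist
  cases p with
  | nil => exact absurd rfl hne
  | @cons _ b _ hadj q =>
    rw [SimpleGraph.Walk.length_cons] at hp
    exact ⟨b, hadj, by have := SimpleGraph.dist_le q; omega⟩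

theorem exists_parentGraph_eq {F : SimpleGraph V} (hF : F.IsAcyclic)
    (hroot : ∀ a, ∃! r, r ∈ S ∧ F.Reachable a r) :
    ∃ f, IsParentMap S f ∧ parentGraph f = F := by
  choose r hr hr' using hroot
  simp only [and_imp] at hr hr'
  have hstep : ∀ a, ∃ b, (a ∈ S → b = a) ∧
      (a ∉ S → F.Adj a b ∧ F.dist b (r b) < F.dist a (r a)) := by
    intro a
    by_cases ha : a ∈ S
    · exact ⟨a, fun _ => rfl, fun h => absurd ha h⟩
    · obtain ⟨b, hadj, hlt⟩ := (hr a).2.exists_adj_dist_lt fun h => ha (h ▸ (hr a).1)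
      have hb : r a = r b := hr' b (r a) (hr a).1 (hadj.symm.reachable.trans (hr a).2)
      exact ⟨b, fun h => absurd h ha, fun _ => ⟨hadj, hb ▸ hlt⟩⟩
  choose f hfS hfn using hstep
  have hpm : IsParentMap S f := by
    refine ⟨hfS, fun a => ?_⟩
    induction hd : F.dist a (r a) using Nat.strong_induction_on generalizing a with
    | _ d ih =>
      by_cases ha : a ∈ S
      · exact ⟨0, ha⟩
      · obtain ⟨k, hk⟩ := ih _ (hd ▸ (hfn a ha).2) (f a) rfl
        exact ⟨k + 1, hk⟩
  have hle : parentGraph f ≤ F := by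
    have h : ∀ a, a ≠ f a → F.Adj a (f a) := fun a ha =>
      (hfn a fun h => ha (hfS a h).symm).1
    intro a b hab
    obtain ⟨hne, rfl | rfl⟩ := parentGraph_adj.1 hab
    · exact h a hne
    · exact (h b hne.symm).symm
  refine ⟨f, hpm, le_antisymm hle fun a b hab => ?_⟩
  by_contra hnab
  refine SimpleGraph.isAcyclic_iff_forall_adj_isBridge.1 hF hab ?_
  have hle' : parentGraph f ≤ F.deleteEdges {s(a, b)} := by
    intro u v huv
    refine SimpleGraph.deleteEdges_adj.2 ⟨hle huv, fun h => ?_⟩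
    have h1 : s(u, v) ∈ (parentGraph f).edgeSet := huv
    rw [Set.mem_singleton_iff.1 h] at h1
    exact hnab h1
  obtain ⟨k, hk⟩ := hpm.2 a
  obtain ⟨l, hl⟩ := hpm.2 b
  have ha := parentGraph_reachable_iterate (f := f) a k
  have hb := parentGraph_reachable_iterate (f := f) b l
  have hkl : f^[k] a = f^[l] b :=
    (hr' a _ hk (ha.mono hle)).trans
      (hr' a _ hl (hab.reachable.trans (hb.mono hle))).symm
  rw [hkl] at ha
  exact (ha.trans hb.symm).mono hle'

theorem IsParentMap.prod_edgeFinset [Fintype V] {M : Type*} [CommMonoid M]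
    (hf : IsParentMap S f) (w : Sym2 V → M) :
    ∏ e ∈ (parentGraph f).edgeFinset, w e = ∏ a with a ∉ S, w s(a, f a) := by
  symm
  refine Finset.prod_bij (fun a _ => s(a, f a)) ?_ ?_ ?_ (fun _ _ => rfl)
  · intro a ha
    have haS : a ∉ S := by simpa using ha
    rw [SimpleGraph.mem_edgeFinset, SimpleGraph.mem_edgeSet, parentGraph_adj]
    exact ⟨fun h => hf.notMem_periodicPts haS ⟨1, one_pos, h.symm⟩, Or.inl rfl⟩
  · intro a ha b hb hab
    have haS : a ∉ S := by simpa using ha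
    rcases Sym2.eq_iff.1 hab with h | ⟨h1, h2⟩
    · exact h.1
    · exact absurd ⟨2, two_pos, show f (f a) = a by rw [h2, ← h1]⟩ (hf.notMem_periodicPts haS)
  · intro e he
    induction e using Sym2.ind with
    | _ a b =>
      rw [SimpleGraph.mem_edgeFinset, SimpleGraph.mem_edgeSet, parentGraph_adj] at he
      obtain ⟨hne, rfl | rfl⟩ := he
      · exact ⟨a, by simpa using fun h => hne (hf.1 a h).symm, rfl⟩
      · exact ⟨b, by simpa using fun h => hne (hf.1 b h), Sym2.eq_swap⟩

end ParentMap

section PinnedMatrix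

open Matrix

variable {V : Type*} [DecidableEq V] {S : Set V} {f J : V → V}

/-- The matrix whose row `a` is the basis vector at `J a` for `a ∈ S`, and the difference of the
basis vectors at `a` and `f a` for `a ∉ S`. -/
noncomputable def pinnedMatrix (S : Set V) (J f : V → V) : Matrix V V ℤ :=
  Matrix.of fun a => if a ∈ S then Pi.single (J a) 1 else Pi.single a 1 - Pi.single (f a) 1

theorem pinnedMatrix_mul_apply [Fintype V] (X : Matrix V V ℤ) (a c : V) :
    (pinnedMatrix S J f * X) a c = if a ∈ S then X (J a) c else X a c - X (f a) c := by
  rw [Matrix.mul_apply]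
  by_cases ha : a ∈ S
  · simp [pinnedMatrix, ha, Pi.single_apply]
  · simp [pinnedMatrix, ha, Pi.single_apply, sub_mul]

theorem IsParentMap.det_pinnedMatrix_id [Fintype V] (hf : IsParentMap S f) :
    (pinnedMatrix S id f).det = 1 := by
  set A : Matrix V V ℤ := 1 - pinnedMatrix S id f with hA
  have hmul : ∀ (X : Matrix V V ℤ) a c, (A * X) a c = if a ∈ S then 0 else X (f a) c := by
    intro X a c
    rw [hA, Matrix.sub_mul, Matrix.one_mul, Matrix.sub_apply, pinnedMatrix_mul_apply]
    split_ifs <;> simp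
  have hpow : ∀ k a c, f^[k] a ∈ S → (A ^ (k + 1)) a c = 0 := by
    intro k
    induction k with
    | zero => intro a c ha; rw [pow_succ', hmul]; exact if_pos ha
    | succ k ih =>
      intro a c ha
      rw [pow_succ', hmul]
      split_ifs
      · rfl
      · exact ih (f a) c ha
  obtain ⟨N, hN⟩ := hf.exists_iterate_mem
  have hnil : IsNilpotent A := ⟨N + 1, Matrix.ext fun a c => hpow N a c (hN a)⟩
  have hchar := (Matrix.isNilpotent_charpoly_sub_pow_of_isNilpotent hnil).eq_zero
  have heval := Matrix.eval_charpoly A 1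
  rw [sub_eq_zero.1 hchar] at heval
  simpa [hA] using heval.symm

theorem IsParentMap.det_pinnedMatrix [Fintype V] (hf : IsParentMap S f) (J : V → V) :
    (pinnedMatrix S J f).det =
      (Matrix.of fun a c : S => if ∃ k, f^[k] (J a) = c then (1 : ℤ) else 0).det := by
  set X := (pinnedMatrix S id f)⁻¹
  have hX : pinnedMatrix S id f * X = 1 :=
    Matrix.mul_nonsing_inv _ (by simp [hf.det_pinnedMatrix_id])
  have hdX : X.det = 1 := by
    have h := congrArg Matrix.det hX
    rwa [Matrix.det_mul, hf.det_pinnedMatrix_id, one_mul, Matrix.det_one] at h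
  have hXS : ∀ a ∈ S, ∀ c, X a c = (1 : Matrix V V ℤ) a c := by
    intro a ha c
    rw [← hX, pinnedMatrix_mul_apply, if_pos ha, id]
  have hXn : ∀ a ∉ S, ∀ c, X a c - X (f a) c = (1 : Matrix V V ℤ) a c := by
    intro a ha c
    rw [← hX, pinnedMatrix_mul_apply, if_neg ha]
  have hXf : ∀ a, ∀ c ∈ S, X a c = X (f a) c := by
    intro a c hc
    by_cases ha : a ∈ S
    · rw [hf.1 a ha]
    · have h := hXn a ha c
      rw [Matrix.one_apply_ne (ne_of_mem_of_not_mem hc ha).symm] at h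
      exact sub_eq_zero.1 h
  have hXk : ∀ k a, ∀ c ∈ S, X a c = X (f^[k] a) c := by
    intro k
    induction k with
    | zero => intros; rfl
    | succ k ih => intro a c hc; rw [hXf a c hc, ih _ c hc]; rfl
  have hXc : ∀ a, ∀ c ∈ S, X a c = if ∃ k, f^[k] a = c then 1 else 0 := by
    intro a c hc
    split_ifs with h
    · obtain ⟨k, rfl⟩ := h
      rw [hXk k a _ hc, hXS _ hc, Matrix.one_apply_eq]
    · obtain ⟨k, hk⟩ := hf.2 a
      rw [hXk k a _ hc, hXS _ hk, Matrix.one_apply_ne fun h' => h ⟨k, h'⟩]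
  have hQ : (pinnedMatrix S J f).det = (pinnedMatrix S J f * X).det := by
    rw [Matrix.det_mul, hdX, mul_one]
  have hQn : ∀ a ∉ S, ∀ c, (pinnedMatrix S J f * X) a c = (1 : Matrix V V ℤ) a c := by
    intro a ha c
    rw [pinnedMatrix_mul_apply, if_neg ha, hXn a ha]
  rw [hQ, Matrix.twoBlockTriangular_det _ (· ∈ S) fun a ha c hc => by
    rw [hQn a ha, Matrix.one_apply_ne (ne_of_mem_of_not_mem hc ha).symm]]
  have h1 : Matrix.toSquareBlockProp (pinnedMatrix S J f * X) (fun a => ¬ a ∈ S) = 1 := by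
    ext a c
    rw [Matrix.toSquareBlockProp_def, Matrix.of_apply, hQn a a.2]
    simp [Matrix.one_apply, Subtype.ext_iff]
  rw [h1, Matrix.det_one, mul_one]
  refine congrArg Matrix.det (Matrix.ext fun a c => ?_)
  rw [Matrix.toSquareBlockProp_def, Matrix.of_apply, Matrix.of_apply, pinnedMatrix_mul_apply,
    if_pos a.2, hXc _ _ c.2]

theorem det_pinnedMatrix_eq_zero [Fintype V] (hS : ∀ a ∈ S, f a = a) (hf : ¬ IsParentMap S f)
    (J : V → V) : (pinnedMatrix S J f).det = 0 := by
  obtain ⟨a, ha⟩ : ∃ a, ∀ k, f^[k] a ∉ S := by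
    by_contra! h
    exact hf ⟨hS, h⟩
  obtain ⟨k, l, hkl, heq⟩ := Finite.exists_ne_map_eq_of_infinite fun k => f^[k] a
  wlog hlt : k < l generalizing k l
  · exact this l k hkl.symm heq.symm (by omega)
  have hper : f^[k] a ∈ Function.periodicPts f := by
    refine ⟨l - k, by omega, ?_⟩
    change f^[l - k] (f^[k] a) = f^[k] a
    rw [← Function.iterate_add_apply, Nat.sub_add_cancel hlt.le]
    exact heq.symm
  set P : Finset V := univ.filter fun b => b ∈ Function.periodicPts f ∧ b ∉ S with hP
  have hbij := Function.bijOn_periodicPts f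
  have hPf : ∀ b ∈ P, f b ∈ P := by
    intro b hb
    simp only [hP, mem_filter, mem_univ, true_and] at hb ⊢
    refine ⟨hbij.mapsTo hb.1, fun h => hb.2 ?_⟩
    rwa [← hbij.injOn (hbij.mapsTo hb.1) hb.1 (hS _ h)]
  rw [← Matrix.exists_vecMul_eq_zero_iff]
  refine ⟨fun b => if b ∈ P then 1 else 0, fun h => ?_, ?_⟩
  · have h' := congrFun h (f^[k] a)
    simp [hP, hper, ha k] at h'
  · have hPinj : Set.InjOn f P := hbij.injOn.mono fun b hb => by
      simp only [hP, coe_filter, mem_univ, true_and, Set.mem_ofPred_eq] at hb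
      exact hb.1
    have himg : P.image f = P :=
      Finset.eq_of_subset_of_card_le (Finset.image_subset_iff.2 hPf)
        (Finset.card_image_of_injOn hPinj).ge
    have hrow : ∀ b ∈ P, ∀ c, pinnedMatrix S J f b c =
        (Pi.single b 1 : V → ℤ) c - (Pi.single (f b) 1 : V → ℤ) c := by
      intro b hb c
      simp [pinnedMatrix, (mem_filter.1 hb).2.2]
    funext c
    simp only [Matrix.vecMul, dotProduct, ite_mul, one_mul, zero_mul, Finset.sum_ite_mem,
      univ_inter, Pi.zero_apply]
    rw [Finset.sum_congr rfl fun b hb => hrow b hb c, Finset.sum_sub_distrib,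
      ← Finset.sum_image (g := f) (f := fun b => (Pi.single b 1 : V → ℤ) c) hPinj, himg, sub_self]

theorem det_pinned_laplacian [Fintype V] {R : Type*} [CommRing R] (w : V → V → R)
    (S : Set V) (J : V → V) :
    (Matrix.of fun a => if a ∈ S then (Pi.single (J a) 1 : V → R)
        else ∑ b, w a b • (Pi.single a 1 - Pi.single b 1)).det =
      ∑ f with IsParentMap S f, (∏ a with a ∉ S, w a (f a)) *
        ((Matrix.of fun a c : S => if ∃ k, f^[k] (J a) = c then (1 : ℤ) else 0).det : R) := by
  have hcast : ∀ f : V → V, (Matrix.detRowAlternating (R := R) fun a =>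
      if a ∈ S then (Pi.single (J a) 1 : V → R) else Pi.single a 1 - Pi.single (f a) 1) =
        ((pinnedMatrix S J f).det : R) := by
    intro f
    rw [Int.cast_det]
    refine congrArg Matrix.det (Matrix.ext fun a c => ?_)
    by_cases ha : a ∈ S
    · simp [pinnedMatrix, ha, Pi.single_apply]
    · simp [pinnedMatrix, ha, Pi.single_apply]
  have hrow : (fun a => if a ∈ S then (Pi.single (J a) 1 : V → R)
        else ∑ b, w a b • (Pi.single a 1 - Pi.single b 1)) = fun a =>
      ∑ b, (if a ∈ S then (if b = a then (1 : R) else 0) else w a b) •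
        (if a ∈ S then (Pi.single (J a) 1 : V → R) else Pi.single a 1 - Pi.single b 1) := by
    funext a
    by_cases ha : a ∈ S <;> simp [ha]
  rw [hrow]
  refine ((Matrix.detRowAlternating (R := R)).toMultilinearMap.map_sum _).trans ?_
  rw [Finset.sum_filter]
  refine Finset.sum_congr rfl fun f _ => ?_
  rw [MultilinearMap.map_smul_univ]
  refine (congrArg _ (hcast f)).trans ?_
  rw [smul_eq_mul]
  by_cases hS : ∀ a ∈ S, f a = a
  · split_ifs with hf
    · rw [hf.det_pinnedMatrix, Finset.prod_filter]
      congr 1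
      refine Finset.prod_congr rfl fun a _ => ?_
      by_cases ha : a ∈ S
      · simp [ha, hS a ha]
      · simp [ha]
    · rw [det_pinnedMatrix_eq_zero hS hf, Int.cast_zero, mul_zero]
  · rw [if_neg fun hf => hS hf.1]
    push Not at hS
    obtain ⟨a, ha, hne⟩ := hS
    rw [Finset.prod_eq_zero (mem_univ a) (by simp [ha, hne]), zero_mul]

end PinnedMatrix

section Shuffle

variable {m k : ℕ}

theorem card_lt_add_eq_of_strictMono {i : Fin m → Fin (m + k)} {c : Fin k → Fin (m + k)}
    (hi : StrictMono i) (e : Fin m ⊕ Fin k ≃ Fin (m + k))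
    (he : ⇑e = Sum.elim i c) (p : Fin m) : #{q | c q < i p} + p = (i p : ℕ) := by
  have h1 : #{x | x < i p} = (i p : ℕ) := by
    rw [Finset.filter_gt_eq_Iio, Fin.card_Iio]
  have h2 : #{p' | i p' < i p} = (p : ℕ) := by
    simp_rw [hi.lt_iff_lt]
    rw [Finset.filter_gt_eq_Iio, Fin.card_Iio]
  have hl : ∀ p', e (Sum.inl p') = i p' := fun p' => by rw [he, Sum.elim_inl]
  have hr : ∀ q, e (Sum.inr q) = c q := fun q => by rw [he, Sum.elim_inr]
  rw [Finset.card_filter, ← Equiv.sum_comp e, Fintype.sum_sum_type] at h1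
  simp only [hl, hr] at h1
  rw [← Finset.card_filter, ← Finset.card_filter, h2] at h1
  omega

/-- The sign of an `(m, k)`-shuffle. -/
theorem sign_shuffle {i : Fin m → Fin (m + k)} {c : Fin k → Fin (m + k)}
    (hi : StrictMono i) (hc : StrictMono c) (e : Fin m ⊕ Fin k ≃ Fin (m + k))
    (he : ⇑e = Sum.elim i c) :
    Equiv.Perm.sign (finSumFinEquiv.symm.trans e) * (-1) ^ (∑ p : Fin m, (p : ℕ)) =
      (-1) ^ (∑ p, (i p : ℕ)) := by
  have hl : ∀ p, (finSumFinEquiv.symm.trans e) (Fin.castAdd k p) = i p := by simp [he]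
  have hr : ∀ q, (finSumFinEquiv.symm.trans e) (Fin.natAdd m q) = c q := by simp [he]
  have hsign : Equiv.Perm.sign (finSumFinEquiv.symm.trans e) =
      ∏ p, ∏ q, if i p < c q then (1 : ℤˣ) else -1 := by
    rw [Equiv.Perm.sign_eq_prod_prod_Iio, Fin.prod_univ_add, Finset.prod_comm (s := univ)]
    have h1 : ∀ (σ : Equiv.Perm (Fin (m + k))) (y : Fin (m + k)),
        (∏ x ∈ Iio y, if σ x < σ y then (1 : ℤˣ) else -1) =
          ∏ x, if x < y then (if σ x < σ y then 1 else -1) else 1 := by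
      intro σ y
      rw [← Finset.prod_filter, Finset.filter_gt_eq_Iio]
    simp_rw [h1 (finSumFinEquiv.symm.trans e)]
    simp only [Fin.prod_univ_add, hl, hr]
    rw [Finset.prod_eq_one, one_mul]
    · refine Finset.prod_congr rfl fun q _ => ?_
      rw [Finset.prod_eq_one (s := univ) (f := fun x : Fin k => _), mul_one]
      · refine Finset.prod_congr rfl fun p _ => if_pos ?_
        simp only [Fin.lt_def, Fin.val_castAdd, Fin.val_natAdd]
        omega
      · intro q' _
        simp only [Fin.natAdd_lt_natAdd_iff, hc.lt_iff_lt]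
        split_ifs <;> rfl
    · intro p _
      rw [Finset.prod_eq_one, Finset.prod_eq_one, one_mul]
      · intro q _
        refine if_neg ?_
        simp only [Fin.lt_def, Fin.val_castAdd, Fin.val_natAdd]
        omega
      · intro p' _
        have hlt : Fin.castAdd k p' < Fin.castAdd k p ↔ p' < p := Iff.rfl
        simp only [hlt, hi.lt_iff_lt]
        split_ifs <;> rfl
  rw [hsign, ← Finset.prod_pow_eq_pow_sum, ← Finset.prod_pow_eq_pow_sum, ← Finset.prod_mul_distrib]
  refine Finset.prod_congr rfl fun p _ => ?_
  have hprod : (∏ q, if i p < c q then (1 : ℤˣ) else -1) = (-1) ^ #{q | c q < i p} := by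
    rw [← Finset.prod_const, Finset.prod_filter]
    refine Finset.prod_congr rfl fun q _ => ?_
    have hne : c q ≠ i p := fun h => by
      have h' : e (Sum.inr q) = e (Sum.inl p) := by simp [he, h]
      simpa using e.injective h'
    rcases hne.lt_or_gt with h | h
    · rw [if_pos h, if_neg h.not_gt]
    · rw [if_pos h, if_neg h.not_gt]
  rw [hprod, ← pow_add, card_lt_add_eq_of_strictMono hi e he]

theorem exists_equiv_sumElim_compl {i : Fin m → Fin (m + k)} (hi : Function.Injective i)
    (hr : (univ \ univ.image i).card = k) :
    ∃ e : Fin m ⊕ Fin k ≃ Fin (m + k),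
      ⇑e = Sum.elim i fun a => ((univ \ univ.image i).orderIsoOfFin hr a : Fin (m + k)) := by
  have hinj : Function.Injective
      (Sum.elim i fun a => ((univ \ univ.image i).orderIsoOfFin hr a : Fin (m + k))) := by
    refine hi.sumElim (Subtype.val_injective.comp (OrderIso.injective _)) fun p q h => ?_
    have hq := ((univ \ univ.image i).orderIsoOfFin hr q).2
    rw [← h] at hq
    simp at hq
  exact ⟨Equiv.ofBijective _ ((Fintype.bijective_iff_injective_and_card _).2 ⟨hinj, by simp⟩), rfl⟩

theorem det_submatrix_compl {R : Type*} [CommRing R]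
    (M : Matrix (Fin (m + k)) (Fin (m + k)) R) {i j : Fin m → Fin (m + k)}
    (hi : StrictMono i) (hj : StrictMono j) (hM : ∀ p c, M (i p) c = if c = j p then 1 else 0)
    (hr : (univ \ univ.image i).card = k) (hc : (univ \ univ.image j).card = k) :
    (-1 : R) ^ (∑ p, ((i p : ℕ) + (j p : ℕ))) *
      (M.submatrix (fun a => ((univ \ univ.image i).orderIsoOfFin hr a : Fin (m + k)))
        (fun a => ((univ \ univ.image j).orderIsoOfFin hc a : Fin (m + k)))).det = M.det := by
  obtain ⟨eI, heI⟩ := exists_equiv_sumElim_compl hi.injective hr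
  obtain ⟨eJ, heJ⟩ := exists_equiv_sumElim_compl hj.injective hc
  have hcI : StrictMono fun a => ((univ \ univ.image i).orderIsoOfFin hr a : Fin (m + k)) :=
    fun a b hab => Subtype.coe_lt_coe.2 (OrderIso.strictMono _ hab)
  have hcJ : StrictMono fun a => ((univ \ univ.image j).orderIsoOfFin hc a : Fin (m + k)) :=
    fun a b hab => Subtype.coe_lt_coe.2 (OrderIso.strictMono _ hab)
  have hsI := sign_shuffle hi hcI eI heI
  have hsJ := sign_shuffle hj hcJ eJ heJ
  set σI : Equiv.Perm (Fin (m + k)) := finSumFinEquiv.symm.trans eI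
  set σJ : Equiv.Perm (Fin (m + k)) := finSumFinEquiv.symm.trans eJ
  have hblock : (M.submatrix eI eJ).det =
      (M.submatrix (fun a => ((univ \ univ.image i).orderIsoOfFin hr a : Fin (m + k)))
        (fun a => ((univ \ univ.image j).orderIsoOfFin hc a : Fin (m + k)))).det := by
    have h11 : (M.submatrix eI eJ).toBlocks₁₁ = 1 := by
      ext p q
      simp [Matrix.toBlocks₁₁, heI, heJ, hM, Matrix.one_apply, hj.injective.eq_iff, eq_comm]
    have h12 : (M.submatrix eI eJ).toBlocks₁₂ = 0 := by
      ext p q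
      have hne : eJ (Sum.inr q) ≠ j p := fun h => by
        have h' : eJ (Sum.inr q) = eJ (Sum.inl p) := by rw [h, heJ]; rfl
        simpa using eJ.injective h'
      simp only [Matrix.toBlocks₁₂, Matrix.of_apply, Matrix.submatrix_apply, Matrix.zero_apply]
      rw [heI, Sum.elim_inl, hM, if_neg hne]
    rw [← Matrix.fromBlocks_toBlocks (M.submatrix eI eJ), h11, h12, Matrix.det_fromBlocks_zero₁₂,
      Matrix.det_one, one_mul]
    refine congrArg Matrix.det (Matrix.ext fun p q => ?_)
    simp [Matrix.toBlocks₂₂, heI, heJ]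
  have hperm : (M.submatrix eI eJ).det =
      ((Equiv.Perm.sign σI * Equiv.Perm.sign σJ : ℤˣ) : ℤ) * M.det := by
    have h : M.submatrix eI eJ =
        ((M.submatrix id σJ).submatrix σI id).submatrix finSumFinEquiv finSumFinEquiv := by
      ext p q
      simp [σI, σJ]
    rw [h, Matrix.det_submatrix_equiv_self, Matrix.det_permute, Matrix.det_permute']
    push_cast
    ring
  have hsign : ((-1) ^ (∑ p, ((i p : ℕ) + (j p : ℕ))) : ℤˣ) =
      Equiv.Perm.sign σI * Equiv.Perm.sign σJ := by
    rw [Finset.sum_add_distrib, pow_add, ← hsI, ← hsJ, mul_mul_mul_comm, Int.units_mul_self, mul_one]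
  have hR : (-1 : R) ^ (∑ p, ((i p : ℕ) + (j p : ℕ))) =
      ((Equiv.Perm.sign σI * Equiv.Perm.sign σJ : ℤˣ) : ℤ) := by
    rw [← hsign]
    push_cast
    rfl
  rw [← hblock, hperm, hR, ← mul_assoc, ← Int.cast_mul, Int.units_coe_mul_self, Int.cast_one,
    one_mul]

end Shuffle

section Forest

variable {V : Type*} {m : ℕ} {i j : Fin m → V}

theorem forall_existsUnique_component_iff {F : SimpleGraph V} (hi : Function.Injective i) :
    (∀ c : F.ConnectedComponent, ∃! p, F.connectedComponentMk (i p) = c) ↔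
      ∀ a, ∃! r, r ∈ Set.range i ∧ F.Reachable a r := by
  rw [SimpleGraph.ConnectedComponent.forall]
  refine forall_congr' fun a => ?_
  simp only [SimpleGraph.ConnectedComponent.eq]
  constructor
  · rintro ⟨p, hp, hu⟩
    refine ⟨i p, ⟨⟨p, rfl⟩, SimpleGraph.Reachable.symm hp⟩, ?_⟩
    rintro _ ⟨⟨q, rfl⟩, hq⟩
    rw [hu q hq.symm]
  · rintro ⟨_, ⟨⟨p, rfl⟩, hp⟩, hu⟩
    exact ⟨p, hp.symm, fun q hq => hi (hu _ ⟨⟨q, rfl⟩, SimpleGraph.Reachable.symm hq⟩)⟩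

theorem IsParentMap.existsUnique_reachable {S : Set V} {f : V → V} (hf : IsParentMap S f) (a : V) :
    ∃! r, r ∈ S ∧ (parentGraph f).Reachable a r := by
  obtain ⟨k, hk⟩ := hf.2 a
  refine ⟨f^[k] a, ⟨hk, parentGraph_reachable_iterate a k⟩, ?_⟩
  rintro r ⟨hr, har⟩
  obtain ⟨l, rfl⟩ := (parentGraph_reachable_iff hf.1 hr).1 har.symm
  rcases le_total k l with h | h
  · exact iterate_eq_of_le hf.1 hk h
  · exact (iterate_eq_of_le hf.1 hr h).symm

theorem card_component_eq_and_existsUnique [Fintype V] {F : SimpleGraph V} {γ : Equiv.Perm (Fin m)}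
    (h : ∀ c : F.ConnectedComponent, ∃! p, F.connectedComponentMk (i p) = c)
    (hγ : ∀ p, F.Reachable (i p) (j (γ p))) :
    Fintype.card F.ConnectedComponent = m ∧
      ∀ c : F.ConnectedComponent, ∃! q, F.connectedComponentMk (j q) = c := by
  have hbij := Function.bijective_iff_existsUnique _ |>.2 h
  constructor
  · rw [← Fintype.card_of_bijective hbij, Fintype.card_fin]
  · rw [← Function.bijective_iff_existsUnique]
    have hcomp : (fun p => F.connectedComponentMk (i p)) =
        (fun q => F.connectedComponentMk (j q)) ∘ γ :=
      funext fun p => SimpleGraph.ConnectedComponent.eq.2 (hγ p)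
    rw [hcomp] at hbij
    exact (γ.bijective.of_comp_iff _).1 hbij

theorem prod_edgeFinset_eq_zero [Fintype V] {R : Type*} [CommRing R] {F G : SimpleGraph V} (hFG : ¬ F ≤ G)
    {w : V → V → R} (hsym : ∀ a b, w a b = w b a) (hw : ∀ a b, ¬ G.Adj a b → w a b = 0) :
    ∏ e ∈ F.edgeFinset, Sym2.lift ⟨w, hsym⟩ e = 0 := by
  obtain ⟨a, b, hF, hG⟩ : ∃ a b, F.Adj a b ∧ ¬ G.Adj a b := by
    by_contra! h
    exact hFG fun a b => h a b
  exact Finset.prod_eq_zero (i := s(a, b)) (SimpleGraph.mem_edgeFinset.2 hF) (hw a b hG)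

theorem sum_parentMap_eq_sum_forest [Fintype V] [DecidableEq V] {M R : Type*}
    [AddCommMonoid M] [CommRing R] (hi : Function.Injective i) {S : Set V} (hS : Set.range i = S) (w : Sym2 V → R)
    (φ : SimpleGraph V → R → M) :
    ∑ f with IsParentMap S f, φ (parentGraph f) (∏ a with a ∉ S, w s(a, f a)) =
      ∑ F : SimpleGraph V with F.IsAcyclic ∧
        ∀ c : F.ConnectedComponent, ∃! p, F.connectedComponentMk (i p) = c,
        φ F (∏ e ∈ F.edgeFinset, w e) := by
  have hcomp := fun F : SimpleGraph V => hS ▸ forall_existsUnique_component_iff (F := F) hi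
  refine Finset.sum_bij (fun f _ => parentGraph f) ?_ ?_ ?_ ?_
  · intro f hf
    have hf' := (mem_filter.1 hf).2
    exact mem_filter.2 ⟨mem_univ _, hf'.isAcyclic,
      (hcomp _).2 hf'.existsUnique_reachable⟩
  · intro f hf g hg h
    exact parentGraph_injOn (mem_filter.1 hf).2 (mem_filter.1 hg).2 h
  · intro F hF
    obtain ⟨-, hF, hc⟩ := mem_filter.1 hF
    obtain ⟨f, hf, rfl⟩ := exists_parentGraph_eq hF ((hcomp _).1 hc)
    exact ⟨f, mem_filter.2 ⟨mem_univ _, hf⟩, rfl⟩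
  · intro f hf
    rw [(mem_filter.1 hf).2.prod_edgeFinset w]

end Forest

theorem det_of_range_eq_sum_perm {V : Type*} {m : ℕ} {i : Fin m → V} (hi : Function.Injective i)
    {S : Set V} (hS : Set.range i = S) [Fintype S] [DecidableEq S] (r : V → V → Prop) :
    (Matrix.of fun a c : S => if r a c then (1 : ℤ) else 0).det =
      ∑ σ : Equiv.Perm (Fin m), if ∀ p, r (i (σ p)) (i p) then (Equiv.Perm.sign σ : ℤ) else 0 := by
  subst hS
  rw [← Matrix.det_submatrix_equiv_self (Equiv.ofInjective i hi), Matrix.det_apply]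
  refine Finset.sum_congr rfl fun σ _ => ?_
  simp only [Matrix.submatrix_apply, Matrix.of_apply, Equiv.ofInjective_apply]
  split_ifs with h
  · rw [Finset.prod_eq_one fun p _ => if_pos (h p), Units.smul_def, smul_eq_mul, mul_one]
  · push Not at h
    obtain ⟨p, hp⟩ := h
    rw [Finset.prod_eq_zero (mem_univ p) (if_neg hp), smul_zero]

/-- Chaiken's all-minors matrix-tree theorem.  `J` is given by the strictly increasing
enumeration `i` of its first coordinates together with the injective list `j` of second
coordinates; `τ` is the permutation sorting the `j`'s.  `(-1)^{ΣJ} det L(J)`, where `L(J)`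
deletes the rows `i₁, …, i_m` and the columns `j₁, …, j_m`, equals the sum over all
`J`-admissible spanning forests `F` of `G` (forests with `m` components, each containing
exactly one of the `i`'s and exactly one of the `j`'s), with `γ` the permutation matching
`i_p` to the `j` in its component, of `ε(τ ∘ γ) w(F)`. -/
theorem stmt_15 (n m : ℕ) {R : Type*} [CommRing R] (G : SimpleGraph (Fin n))
    (w : Fin n → Fin n → R) (hsym : ∀ a b, w a b = w b a)
    (hw : ∀ a b, ¬ G.Adj a b → w a b = 0)
    (L : Matrix (Fin n) (Fin n) R)
    (hL : ∀ a b, L a b = if a = b then ∑ c ∈ univ.erase a, w a c else - w a b)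
    (i j : Fin m → Fin n) (hi : StrictMono i) (hj : Function.Injective j)
    (τ : Equiv.Perm (Fin m)) (hτ : StrictMono (fun p => j (τ p)))
    (hr : ((univ : Finset (Fin n)) \ univ.image i).card = n - m)
    (hc : ((univ : Finset (Fin n)) \ univ.image j).card = n - m) :
    (-1 : R) ^ (∑ p, ((i p : ℕ) + (j p : ℕ))) *
        (L.submatrix
          (fun a => (((univ : Finset (Fin n)) \ univ.image i).orderIsoOfFin hr a : Fin n))
          (fun a => (((univ : Finset (Fin n)) \ univ.image j).orderIsoOfFin hc a : Fin n))).det =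
      ∑ F : SimpleGraph (Fin n), ∑ γ : Equiv.Perm (Fin m),
        if F ≤ G ∧ F.IsAcyclic ∧ Fintype.card F.ConnectedComponent = m ∧
            (∀ c : F.ConnectedComponent, ∃! p, F.connectedComponentMk (i p) = c) ∧
            (∀ c : F.ConnectedComponent, ∃! q, F.connectedComponentMk (j q) = c) ∧
            (∀ p, F.Reachable (i p) (j (γ p))) then
          (Equiv.Perm.sign (τ * γ) : ℤ) • ∏ e ∈ F.edgeFinset, Sym2.lift ⟨w, hsym⟩ e
        else 0 := by
  obtain ⟨k, rfl⟩ : ∃ k, n = m + k := by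
    have h := Fintype.card_le_of_injective i hi.injective
    simp only [Fintype.card_fin] at h
    exact Nat.exists_eq_add_of_le h
  generalize hk : m + k - m = k' at hr hc ⊢
  obtain rfl : k' = k := by omega
  have haa : ∀ a, w a a = 0 := fun a => hw a a (SimpleGraph.irrefl _)
  have himg : univ.image (fun p => j (τ p)) = univ.image j := by
    ext x
    simp only [mem_image, mem_univ, true_and]
    exact τ.surjective.exists (p := fun q => j q = x) |>.symm
  obtain ⟨S, hS⟩ : ∃ S, Set.range i = S := ⟨_, rfl⟩
  have hiS : ∀ p, i p ∈ S := fun p => hS ▸ Set.mem_range_self p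
  set J : Fin (m + k') → Fin (m + k') := Function.extend i (fun p => j (τ p)) id with hJ
  have hJi : ∀ p, J (i p) = j (τ p) := fun p => hi.injective.extend_apply _ _ _
  set M : Matrix (Fin (m + k')) (Fin (m + k')) R := Matrix.of fun a =>
    if a ∈ S then (Pi.single (J a) 1 : Fin (m + k') → R)
    else ∑ b, w a b • (Pi.single a 1 - Pi.single b 1) with hM
  have hMi : ∀ p c, M (i p) c = if c = j (τ p) then 1 else 0 := by
    intro p c
    simp [hM, hiS, hJi, Pi.single_apply]
  have hML : ∀ a ∉ S, ∀ c, M a c = L a c := by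
    intro a ha c
    have h : M a c = ∑ b, w a b * ((if c = a then 1 else 0) - (if c = b then 1 else 0)) := by
      simp only [hM, Matrix.of_apply, if_neg ha, Finset.sum_apply, Pi.smul_apply, Pi.sub_apply,
        Pi.single_apply, smul_eq_mul]
    rw [h, hL]
    simp only [mul_sub, Finset.sum_sub_distrib, mul_ite, mul_one, mul_zero, Finset.sum_ite_eq,
      mem_univ, if_true]
    by_cases hac : a = c
    · subst hac
      simp [haa]
    · simp [hac, Ne.symm hac]
  have hdet := det_submatrix_compl M hi hτ hMi hr (himg ▸ hc)
  have hsub : (M.submatrix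
      (fun a => ((univ \ univ.image i).orderIsoOfFin hr a : Fin (m + k')))
      (fun a => ((univ \ univ.image fun p => j (τ p)).orderIsoOfFin (himg ▸ hc) a :
        Fin (m + k')))) = L.submatrix
      (fun a => ((univ \ univ.image i).orderIsoOfFin hr a : Fin (m + k')))
      (fun a => ((univ \ univ.image j).orderIsoOfFin hc a : Fin (m + k'))) := by
    ext a c
    have hiso : ∀ (s t : Finset (Fin (m + k'))) (_ : s = t) (hs : #s = k') (ht : #t = k'),
        (s.orderIsoOfFin hs c : Fin (m + k')) = (t.orderIsoOfFin ht c : Fin (m + k')) := by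
      rintro s t rfl _ _
      rfl
    rw [Matrix.submatrix_apply, Matrix.submatrix_apply, hiso (univ \ _) (univ \ _) (congrArg _ himg) _ hc]
    refine hML _ (fun h => ?_) _
    rw [← hS] at h
    have h' := ((univ \ univ.image i).orderIsoOfFin hr a).2
    simp only [mem_sdiff, mem_image, mem_univ, true_and] at h'
    exact h' h
  have hsum : ∑ p, ((i p : ℕ) + (j (τ p) : ℕ)) = ∑ p, ((i p : ℕ) + (j p : ℕ)) := by
    rw [Finset.sum_add_distrib, Finset.sum_add_distrib, Equiv.sum_comp τ fun p => (j p : ℕ)]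
  rw [hsub, hsum] at hdet
  rw [hdet, hM, det_pinned_laplacian]
  set φ : SimpleGraph (Fin (m + k')) → R → R := fun F x => x *
    ((∑ σ : Equiv.Perm (Fin m), if ∀ p, F.Reachable (i p) (j (τ (σ p))) then
      (Equiv.Perm.sign σ : ℤ) else 0 : ℤ) : R) with hφ
  have hleft := sum_parentMap_eq_sum_forest hi.injective hS (Sym2.lift ⟨w, hsym⟩) φ
  refine (Finset.sum_congr rfl fun f hf => ?_).trans (hleft.trans ?_)
  · have hf' := (mem_filter.1 hf).2
    rw [det_of_range_eq_sum_perm hi.injective hS fun a c => ∃ k, f^[k] (J a) = c]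
    simp only [hφ, Sym2.lift_mk, hJi, parentGraph_reachable_iff hf'.1 (hiS _)]
  · rw [Finset.sum_filter]
    refine Finset.sum_congr rfl fun F _ => ?_
    split_ifs with hF
    · rw [hφ]
      dsimp only
      rw [Int.cast_sum, Finset.mul_sum]
      refine Fintype.sum_equiv (Equiv.mulLeft τ) _ _ fun σ => ?_
      by_cases hσ : ∀ p, F.Reachable (i p) (j (τ (σ p)))
      · obtain ⟨h1, h2⟩ := card_component_eq_and_existsUnique (γ := τ * σ) hF.2 hσ
        have hs : Equiv.Perm.sign (τ * (τ * σ)) = Equiv.Perm.sign σ := by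
          rw [Equiv.Perm.sign_mul, Equiv.Perm.sign_mul, ← mul_assoc, Int.units_mul_self, one_mul]
        rw [if_pos hσ]
        by_cases hFG : F ≤ G
        · refine Eq.trans ?_ (if_pos ⟨hFG, hF.1, by convert h1, hF.2, h2, hσ⟩).symm
          rw [Equiv.coe_mulLeft, hs, zsmul_eq_mul, mul_comm]
        · refine Eq.trans ?_ (if_neg fun h => hFG h.1).symm
          rw [prod_edgeFinset_eq_zero hFG hsym hw, zero_mul]
      · refine Eq.trans ?_ (if_neg fun h => hσ h.2.2.2.2.2).symm
        rw [if_neg hσ, Int.cast_zero, mul_zero]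
    · symm
      exact Finset.sum_eq_zero fun γ _ => if_neg fun h => hF ⟨h.2.1, h.2.2.2.1⟩
end
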